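/- Let K : ℕ₀×ℕ₀ → [0,∞) be a symmetric kernel satisfying K_{j,k} ≤ C j² k² for all j,k ∈ ℕ₀ and some C > 0. Let f(0) = (f_j(0))_{j≥0} ∈ Y_2^+ with M_2(f(0)) > 0, and let T_0 < (2 M_2(f(0)) C)^{-1}. Then the EDG system has a solution f = (f_j)_{j≥0} on [0,T_0] with f(t) ∈ Y_2^+, whose components are continuously differentiable and satisfy the EDG differential equations pointwise, and which satisfies M_0(f(t)) = M_0(f(0)) and M_1(f(t)) = M_1(f(0)) for all t ∈ [0,T_0]. -/

import Mathlib

open MeasureTheory Filter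

noncomputable section

/-- Membership in the positive cone `Y_r^+`: componentwise nonnegative sequences with
`∑ j^r f_j < ∞`. -/
def MemYplus (r : ℝ) (g : ℕ → ℝ) : Prop :=
  (∀ j, 0 ≤ g j) ∧ Summable (fun j : ℕ => (j : ℝ) ^ r * g j)

/-- The `p`-th moment `M_p(g) = ∑_{j=0}^∞ j^p g_j`. -/
def mom (p : ℝ) (g : ℕ → ℝ) : ℝ := ∑' j : ℕ, (j : ℝ) ^ p * g j

/-- Right-hand side of the infinite EDG system. -/
def edgRHS (K : ℕ → ℕ → ℝ) (g : ℕ → ℝ) : ℕ → ℝ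
  | 0 => g 1 * (∑' k : ℕ, K 1 k * g k) - g 0 * (∑' k : ℕ, K (k + 1) 0 * g (k + 1))
  | m + 1 =>
      g (m + 2) * (∑' k : ℕ, K (m + 2) k * g k) - g (m + 1) * (∑' k : ℕ, K (m + 1) k * g k)
        - g (m + 1) * (∑' k : ℕ, K (k + 1) (m + 1) * g (k + 1))
        + g m * (∑' k : ℕ, K (k + 1) m * g (k + 1))

/-- Mild solution of the EDG system on a time set `S` (containing `0`), with values in
`Y_r^+`. -/
def IsMildSolutionOn (K : ℕ → ℕ → ℝ) (r : ℝ) (f : ℝ → ℕ → ℝ) (S : Set ℝ) : Prop :=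
  (∀ t ∈ S, MemYplus r (f t)) ∧
  (∀ j : ℕ, ContinuousOn (fun t => f t j) S) ∧
  (∃ B : ℝ, ∀ t ∈ S, (∑' j : ℕ, (j : ℝ) ^ r * f t j) ≤ B) ∧
  (∀ t ∈ S, ∀ j : ℕ, Summable (fun k : ℕ => K j k * f t k)) ∧
  (∀ t ∈ S, ∀ j : ℕ,
    MeasureTheory.IntegrableOn (fun s => ∑' k : ℕ, K j k * f s k) (Set.Icc 0 t)) ∧
  (∀ t ∈ S, f t 0 = f 0 0 + ∫ s in (0:ℝ)..t,
      (f s 1 * (∑' k : ℕ, K 1 k * f s k) - f s 0 * (∑' k : ℕ, K (k + 1) 0 * f s (k + 1)))) ∧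
  (∀ t ∈ S, ∀ m : ℕ, f t (m + 1) = f 0 (m + 1) + ∫ s in (0:ℝ)..t,
      (f s (m + 2) * (∑' k : ℕ, K (m + 2) k * f s k)
        - f s (m + 1) * (∑' k : ℕ, K (m + 1) k * f s k)
        - f s (m + 1) * (∑' k : ℕ, K (k + 1) (m + 1) * f s (k + 1))
        + f s m * (∑' k : ℕ, K (k + 1) m * f s (k + 1))))

/-- Classical (continuously differentiable) solution of the EDG system on a time set `S`. -/
def IsClassicalSolutionOn (K : ℕ → ℕ → ℝ) (f : ℝ → ℕ → ℝ) (S : Set ℝ) : Prop :=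
  (∀ t ∈ S, ∀ j : ℕ, Summable (fun k : ℕ => K j k * f t k) ∧
      Summable (fun k : ℕ => K (k + 1) j * f t (k + 1))) ∧
  (∀ t ∈ S, ∀ j : ℕ, HasDerivWithinAt (fun s => f s j) (edgRHS K (f t) j) S t) ∧
  (∀ j : ℕ, ContinuousOn (fun t => edgRHS K (f t) j) S)

/-- Right-hand side of the truncated EDG system with `N+1` equations. -/
def truncRHS (K : ℕ → ℕ → ℝ) (N : ℕ) (g : ℕ → ℝ) (j : ℕ) : ℝ :=
  if j = 0 then
    g 1 * (∑ k ∈ Finset.range N, K 1 k * g k) - g 0 * (∑ k ∈ Finset.Icc 1 N, K k 0 * g k)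
  else if j = N then
    - g N * (∑ k ∈ Finset.range N, K N k * g k)
      + g (N - 1) * (∑ k ∈ Finset.Icc 1 N, K k (N - 1) * g k)
  else
    g (j + 1) * (∑ k ∈ Finset.range N, K (j + 1) k * g k)
      - g j * (∑ k ∈ Finset.range N, K j k * g k)
      - g j * (∑ k ∈ Finset.Icc 1 N, K k j * g k)
      + g (j - 1) * (∑ k ∈ Finset.Icc 1 N, K k (j - 1) * g k)

/-- `fN` is a (global, `C¹`) solution of the truncated EDG system of size `N`. -/
def IsTruncSolution (K : ℕ → ℕ → ℝ) (N : ℕ) (fN : ℝ → ℕ → ℝ) : Prop :=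
  ∀ t : ℝ, ∀ j ≤ N, HasDerivAt (fun s => fN s j) (truncRHS K N (fN t) j) t

/-- The gelation time `T_gel = inf { t ≥ 0 : ∑ j f_j(t) < ∑ j f_j(0) }`. -/
def gelTime (f : ℝ → ℕ → ℝ) : ℝ :=
  sInf { t : ℝ | 0 ≤ t ∧ (∑' j : ℕ, (j : ℝ) * f t j) < ∑' j : ℕ, (j : ℝ) * f 0 j }

/-- The class `𝒢_{1,∞}`: a nonnegative convex `C²` function `G` on `[0,∞)` with derivative
`G'`, such that `G(0) = G'(0) = 0`, `G'` is concave and positive on `(0,∞)`, and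
`G'(x) → ∞`, `G(x)/x → ∞` as `x → ∞`. -/
structure G1Inf where
  G : ℝ → ℝ
  G' : ℝ → ℝ
  hasDeriv : ∀ x ∈ Set.Ici (0:ℝ), HasDerivWithinAt G (G' x) (Set.Ici 0) x
  contDiff : ContDiffOn ℝ 2 G (Set.Ici 0)
  nonneg : ∀ x ∈ Set.Ici (0:ℝ), 0 ≤ G x
  convex : ConvexOn ℝ (Set.Ici 0) G
  zero : G 0 = 0
  deriv_zero : G' 0 = 0
  concave_deriv : ConcaveOn ℝ (Set.Ici 0) G'
  deriv_pos : ∀ x : ℝ, 0 < x → 0 < G' x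
  tendsto_deriv : Filter.Tendsto G' Filter.atTop Filter.atTop
  tendsto_div : Filter.Tendsto (fun x => G x / x) Filter.atTop Filter.atTop

end

/-- A `C¹` autonomous vector field on `ℝⁿ` which is quasi-positive and conserves the sum of the
coordinates has nonnegative solutions on `[0, T]` for nonnegative initial data. -/
theorem exists_nonneg_solution_of_quasipositive {n : ℕ} {G : (Fin n → ℝ) → (Fin n → ℝ)}
    (hG : ContDiff ℝ 1 G)
    (hpos : ∀ x : Fin n → ℝ, (∀ i, 0 ≤ x i) → ∀ i, x i = 0 → 0 ≤ G x i)
    (hsum : ∀ x, ∑ i, G x i = 0) {x₀ : Fin n → ℝ} (hx₀ : ∀ i, 0 ≤ x₀ i) {T : ℝ} (hT : 0 ≤ T) :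
    ∃ x : ℝ → Fin n → ℝ, x 0 = x₀ ∧ (∀ t ∈ Set.Icc 0 T, ∀ i, 0 ≤ x t i) ∧
      ∀ t ∈ Set.Icc 0 T, HasDerivWithinAt x (G (x t)) (Set.Icc 0 T) t := by
  set M : ℝ := ∑ i, x₀ i with hM
  have hM0 : 0 ≤ M := Finset.sum_nonneg fun i _ => hx₀ i
  let P : (Fin n → ℝ) → (Fin n → ℝ) := fun x i => max 0 (min (x i) M)
  have hP : LipschitzWith 1 P := by
    refine LipschitzWith.of_dist_le_mul fun x y => ?_
    rw [NNReal.coe_one, one_mul]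
    refine (dist_pi_le_iff dist_nonneg).2 fun i => ?_
    refine le_trans ?_ (dist_le_pi_dist x y i)
    simp only [P, Real.dist_eq]
    rw [max_comm, max_comm 0]
    exact (abs_max_sub_max_le_abs _ _ _).trans (abs_min_sub_min_le_max _ _ _ _ |>.trans (by simp))
  let S : Set (Fin n → ℝ) := Set.univ.pi fun _ => Set.Icc 0 M
  have hS : IsCompact S := isCompact_univ_pi fun _ => isCompact_Icc
  have hPS : ∀ x, P x ∈ S := fun x i _ =>
    ⟨le_max_left _ _, max_le hM0 (min_le_right _ _)⟩
  obtain ⟨κ, hκ⟩ := LocallyLipschitzOn.exists_lipschitzOnWith_of_compact hS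
    (hG.locallyLipschitz.locallyLipschitzOn (s := S))
  obtain ⟨L, hL⟩ := hS.exists_bound_of_continuousOn hG.continuous.continuousOn
  have hLip : LipschitzWith κ (fun x => G (P x)) := by
    refine LipschitzWith.of_dist_le_mul fun x y => ?_
    refine (hκ.dist_le_mul _ (hPS x) _ (hPS y)).trans ?_
    gcongr
    simpa using hP.dist_le_mul x y
  have hPL : IsPicardLindelof (fun _ x => G (P x)) (tmin := 0) (tmax := T)
      ⟨0, Set.left_mem_Icc.2 hT⟩ x₀ (L.toNNReal * T.toNNReal) 0 L.toNNReal κ := by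
    refine IsPicardLindelof.of_time_independent (fun x _ => ?_) hLip.lipschitzOnWith ?_
    · exact (hL _ (hPS x)).trans (Real.le_coe_toNNReal L)
    · simp [hT]
  obtain ⟨x, hx0, hx⟩ := hPL.exists_eq_forall_mem_Icc_hasDerivWithinAt₀
  replace hx0 : x 0 = x₀ := hx0
  have hxc : ∀ t ∈ Set.Icc 0 T, ∀ i,
      HasDerivWithinAt (fun s => x s i) (G (P (x t)) i) (Set.Icc 0 T) t :=
    fun t ht => hasDerivWithinAt_pi.1 (hx t ht)
  have hnn : ∀ t ∈ Set.Icc 0 T, ∀ i, 0 ≤ x t i := by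
    intro t ht i
    refine le_of_forall_pos_le_add fun ε hε => ?_
    have key := image_le_of_deriv_right_lt_deriv_boundary (a := 0) (b := T)
      (f := fun s => - x s i) (f' := fun s => - G (P (x s)) i)
      (B := fun s => ε / (1 + T) * (1 + s)) (B' := fun _ => ε / (1 + T))
      (fun s hs => (hxc s hs i).continuousWithinAt.neg)
      (fun s hs => ((hxc s (Set.Ico_subset_Icc_self hs) i).mono_of_mem_nhdsWithin
        (Icc_mem_nhdsGE_of_mem hs)).neg)
      (by
        have : 0 ≤ ε / (1 + T) := by positivity
        simpa [hx0] using (neg_nonpos.2 (hx₀ i)).trans this)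
      (fun s => by simpa using ((hasDerivAt_id s).const_add 1).const_mul (ε / (1 + T)))
      (fun s hs he => ?_) ht
    · have h1 : ε / (1 + T) * (1 + t) ≤ ε := by
        rw [div_mul_eq_mul_div, div_le_iff₀ (by linarith)]
        have := ht.2
        gcongr
      linarith
    · have hε' : 0 < ε / (1 + T) := by positivity
      have hneg : x s i < 0 := by
        have : 0 < ε / (1 + T) * (1 + s) := mul_pos hε' (by linarith [hs.1])
        linarith
      have := hpos (P (x s)) (fun j => le_max_left _ _) i
        (max_eq_left ((min_le_left _ _).trans hneg.le))
      linarith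
  have hxsum : ∀ t ∈ Set.Icc 0 T, ∑ i, x t i = M := by
    have hd : ∀ t ∈ Set.Icc 0 T, HasDerivWithinAt (fun s => ∑ i, x s i) 0 (Set.Icc 0 T) t := by
      intro t ht
      have := HasDerivWithinAt.fun_sum (u := Finset.univ) fun i _ => hxc t ht i
      rwa [hsum] at this
    intro t ht
    have := constant_of_has_deriv_right_zero (fun s hs => (hd s hs).continuousWithinAt)
      (fun s hs => (hd s (Set.Ico_subset_Icc_self hs)).mono_of_mem_nhdsWithin
        (Icc_mem_nhdsGE_of_mem hs)) t ht
    rw [this, hx0]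
  refine ⟨x, hx0, hnn, fun t ht => ?_⟩
  have hPx : P (x t) = x t := by
    funext i
    have : x t i ≤ M := by
      rw [← hxsum t ht]
      exact Finset.single_le_sum (fun j _ => hnn t ht j) (Finset.mem_univ i)
    simp [P, this, hnn t ht i]
  simpa only [hPx] using hx t ht

/-- Discrete Laplacian on `ℕ`, for sequences vanishing at `0`, with the boundary value at `0`
produced by the conservative form of the EDG system. -/
def lap (a : ℕ → ℝ) : ℕ → ℝ
  | 0 => a 1
  | m + 1 => a (m + 2) - 2 * a (m + 1) + a m

/-- The total jump rate `a_j = g_j ∑_k K_{j,k} g_k` out of state `j`. -/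
noncomputable def flux (K : ℕ → ℕ → ℝ) (g : ℕ → ℝ) (j : ℕ) : ℝ := g j * ∑' k : ℕ, K j k * g k

theorem sum_mul_lap (a w : ℕ → ℝ) (ha : a 0 = 0) (n : ℕ) :
    ∑ j ∈ Finset.range (n + 1), w j * lap a j =
      (∑ m ∈ Finset.range n, a (m + 1) * (w (m + 2) - 2 * w (m + 1) + w m))
        + w n * a (n + 1) - w (n + 1) * a n := by
  induction n with
  | zero => simp [lap, ha]
  | succ n ih => rw [Finset.sum_range_succ, ih, Finset.sum_range_succ _ n, lap]; ring

/-- The kernel cut off to the box `[0, N]²`. -/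
def truncKernel (K : ℕ → ℕ → ℝ) (N j k : ℕ) : ℝ := if j ≤ N ∧ k ≤ N then K j k else 0

theorem truncKernel_nonneg {K : ℕ → ℕ → ℝ} (hK : ∀ j k, 0 ≤ K j k) (N j k : ℕ) :
    0 ≤ truncKernel K N j k := by
  unfold truncKernel; split_ifs; exacts [hK j k, le_rfl]

theorem truncKernel_le {K : ℕ → ℕ → ℝ} (hK : ∀ j k, 0 ≤ K j k) (N j k : ℕ) :
    truncKernel K N j k ≤ K j k := by
  unfold truncKernel; split_ifs; exacts [le_rfl, hK j k]

theorem flux_truncKernel (K : ℕ → ℕ → ℝ) (N : ℕ) (g : ℕ → ℝ) (j : ℕ) :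
    flux (truncKernel K N) g j =
      g j * ∑ k ∈ Finset.range (N + 2), truncKernel K N j k * g k := by
  unfold flux
  rw [tsum_eq_sum]
  intro k hk
  have : ¬ (j ≤ N ∧ k ≤ N) := fun h => hk (Finset.mem_range.2 (by omega))
  simp [truncKernel, this]

theorem flux_truncKernel_eq_zero (K : ℕ → ℕ → ℝ) {N : ℕ} (g : ℕ → ℝ) {j : ℕ} (hj : N < j) :
    flux (truncKernel K N) g j = 0 := by
  have : ¬ j ≤ N := by omega
  simp [flux, truncKernel, this]

theorem flux_zero {K : ℕ → ℕ → ℝ} (hK0 : ∀ k, K 0 k = 0) (g : ℕ → ℝ) : flux K g 0 = 0 := by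
  simp [flux, hK0]

theorem truncKernel_zero_left {K : ℕ → ℕ → ℝ} (hK0 : ∀ k, K 0 k = 0) (N k : ℕ) :
    truncKernel K N 0 k = 0 := by
  simp [truncKernel, hK0]

/-- Weighted sums of the truncated right-hand side, after summation by parts. -/
theorem sum_mul_lap_flux_truncKernel {K : ℕ → ℕ → ℝ} (hK0 : ∀ k, K 0 k = 0) (N : ℕ)
    (w g : ℕ → ℝ) :
    ∑ j ∈ Finset.range (N + 2), w j * lap (flux (truncKernel K N) g) j =
      ∑ m ∈ Finset.range (N + 1), flux (truncKernel K N) g (m + 1) *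
        (w (m + 2) - 2 * w (m + 1) + w m) := by
  rw [sum_mul_lap _ _ (flux_zero (truncKernel_zero_left hK0 N) g),
    flux_truncKernel_eq_zero K g (show N < N + 1 by omega),
    flux_truncKernel_eq_zero K g (show N < N + 1 + 1 by omega)]
  simp

/-- Extension by zero of a vector to a sequence. -/
def extendZero {n : ℕ} (x : Fin n → ℝ) (j : ℕ) : ℝ := if h : j < n then x ⟨j, h⟩ else 0

theorem contDiff_extendZero {n : ℕ} (j : ℕ) :
    ContDiff ℝ 1 (fun x : Fin n → ℝ => extendZero x j) := by
  unfold extendZero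
  split_ifs
  · exact contDiff_apply ℝ ℝ _
  · exact contDiff_const

theorem extendZero_nonneg {n : ℕ} {x : Fin n → ℝ} (hx : ∀ i, 0 ≤ x i) (j : ℕ) :
    0 ≤ extendZero x j := by
  unfold extendZero; split_ifs; exacts [hx _, le_rfl]

theorem flux_nonneg {K : ℕ → ℕ → ℝ} (hK : ∀ j k, 0 ≤ K j k) {g : ℕ → ℝ} (hg : ∀ j, 0 ≤ g j)
    (j : ℕ) : 0 ≤ flux K g j :=
  mul_nonneg (hg j) (tsum_nonneg fun k => mul_nonneg (hK j k) (hg k))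

/-- `f` solves on `[0, T]` the EDG system whose kernel is cut off to `[0, N]²`, with initial datum
the truncation of `f₀`. -/
structure IsCutoffSolution (K : ℕ → ℕ → ℝ) (f₀ : ℕ → ℝ) (T : ℝ) (N : ℕ) (f : ℝ → ℕ → ℝ) :
    Prop where
  apply_zero : ∀ j, f 0 j = if j < N + 2 then f₀ j else 0
  nonneg : ∀ t ∈ Set.Icc 0 T, ∀ j, 0 ≤ f t j
  eq_zero : ∀ t j, N + 2 ≤ j → f t j = 0
  hasDeriv : ∀ t ∈ Set.Icc 0 T, ∀ j, HasDerivWithinAt (fun s => f s j)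
    (lap (flux (truncKernel K N) (f t)) j) (Set.Icc 0 T) t

/-- Global nonnegative solutions of the EDG system with truncated kernel. -/
theorem exists_isCutoffSolution {K : ℕ → ℕ → ℝ} (hK : ∀ j k, 0 ≤ K j k)
    (hK0 : ∀ k, K 0 k = 0) {f₀ : ℕ → ℝ} (hf₀ : ∀ j, 0 ≤ f₀ j) {T : ℝ} (hT : 0 ≤ T) (N : ℕ) :
    ∃ f : ℝ → ℕ → ℝ, IsCutoffSolution K f₀ T N f := by
  have hflux : ∀ j, ContDiff ℝ 1
      (fun x : Fin (N + 2) → ℝ => flux (truncKernel K N) (extendZero x) j) := by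
    intro j
    simp only [flux_truncKernel]
    exact (contDiff_extendZero j).mul
      (ContDiff.sum fun k _ => contDiff_const.mul (contDiff_extendZero k))
  let G : (Fin (N + 2) → ℝ) → Fin (N + 2) → ℝ :=
    fun x i => lap (flux (truncKernel K N) (extendZero x)) i
  have hG : ContDiff ℝ 1 G := by
    refine contDiff_pi.2 fun i => ?_
    obtain ⟨j, hj⟩ := i
    cases j with
    | zero => exact hflux 1
    | succ m => exact ((hflux _).sub (contDiff_const.mul (hflux _))).add (hflux _)
  have hGpos : ∀ x : Fin (N + 2) → ℝ, (∀ i, 0 ≤ x i) → ∀ i, x i = 0 → 0 ≤ G x i := by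
    rintro y hy ⟨j, hj⟩ hyj
    have hnn := flux_nonneg (truncKernel_nonneg hK N) (extendZero_nonneg hy)
    cases j with
    | zero => exact hnn 1
    | succ m =>
      have : flux (truncKernel K N) (extendZero y) (m + 1) = 0 := by
        simp [flux, extendZero, hj, hyj]
      change 0 ≤ flux (truncKernel K N) (extendZero y) (m + 2) -
        2 * flux (truncKernel K N) (extendZero y) (m + 1) +
        flux (truncKernel K N) (extendZero y) m
      rw [this]
      linarith [hnn (m + 2), hnn m]
  have hGsum : ∀ x, ∑ i, G x i = 0 := by
    intro y
    rw [Fin.sum_univ_eq_sum_range (fun j => lap (flux (truncKernel K N) (extendZero y)) j)]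
    have := sum_mul_lap_flux_truncKernel hK0 N (fun _ => 1) (extendZero y)
    norm_num at this
    exact this
  obtain ⟨x, hx0, hxnn, hx⟩ := exists_nonneg_solution_of_quasipositive hG hGpos hGsum
    (x₀ := fun i => f₀ i) (fun i => hf₀ i) hT
  refine ⟨fun t => extendZero (x t), fun j => ?_, fun t ht => extendZero_nonneg (hxnn t ht),
    fun t j hj => ?_, fun t ht j => ?_⟩
  · simp [extendZero, hx0]
  · simp [extendZero, hj]
  · by_cases hj : j < N + 2
    · simpa [extendZero, hj] using! hasDerivWithinAt_pi.1 (hx t ht) ⟨j, hj⟩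
    · have hz : lap (flux (truncKernel K N) (extendZero (x t))) j = 0 := by
        obtain ⟨m, rfl⟩ : ∃ m, j = m + 1 := ⟨j - 1, by omega⟩
        rw [lap, flux_truncKernel_eq_zero K _ (show N < m + 2 by omega),
          flux_truncKernel_eq_zero K _ (show N < m + 1 by omega),
          flux_truncKernel_eq_zero K _ (show N < m by omega)]
        simp
      rw [hz]
      simpa [extendZero, hj] using hasDerivWithinAt_const t (Set.Icc 0 T) (0 : ℝ)

theorem flux_truncKernel_le {K : ℕ → ℕ → ℝ} (hK : ∀ j k, 0 ≤ K j k) {C : ℝ}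
    (hKC : ∀ j k : ℕ, K j k ≤ C * (j : ℝ) ^ 2 * (k : ℝ) ^ 2) {g : ℕ → ℝ} (hg : ∀ j, 0 ≤ g j)
    (N j : ℕ) : flux (truncKernel K N) g j ≤
      C * ((j : ℝ) ^ 2 * g j) * ∑ k ∈ Finset.range (N + 2), (k : ℝ) ^ 2 * g k := by
  rw [flux_truncKernel]
  calc g j * ∑ k ∈ Finset.range (N + 2), truncKernel K N j k * g k
      ≤ g j * ∑ k ∈ Finset.range (N + 2), C * (j : ℝ) ^ 2 * (k : ℝ) ^ 2 * g k := by
        refine mul_le_mul_of_nonneg_left (Finset.sum_le_sum fun k _ => ?_) (hg j)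
        exact mul_le_mul_of_nonneg_right ((truncKernel_le hK N j k).trans (hKC j k)) (hg k)
    _ = _ := by
        rw [Finset.mul_sum, Finset.mul_sum]
        exact Finset.sum_congr rfl fun k _ => by ring

namespace IsCutoffSolution

variable {K : ℕ → ℕ → ℝ} {f₀ : ℕ → ℝ} {T : ℝ} {N : ℕ} {f : ℝ → ℕ → ℝ}

theorem hasDerivWithinAt_sum (h : IsCutoffSolution K f₀ T N f) (hK0 : ∀ k, K 0 k = 0)
    (w : ℕ → ℝ) {t : ℝ} (ht : t ∈ Set.Icc 0 T) :
    HasDerivWithinAt (fun s => ∑ j ∈ Finset.range (N + 2), w j * f s j)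
      (∑ m ∈ Finset.range (N + 1), flux (truncKernel K N) (f t) (m + 1) *
        (w (m + 2) - 2 * w (m + 1) + w m)) (Set.Icc 0 T) t := by
  rw [← sum_mul_lap_flux_truncKernel hK0]
  exact HasDerivWithinAt.fun_sum fun j _ => (h.hasDeriv t ht j).const_mul (w j)

theorem sum_init (h : IsCutoffSolution K f₀ T N f) (w : ℕ → ℝ) :
    ∑ j ∈ Finset.range (N + 2), w j * f 0 j = ∑ j ∈ Finset.range (N + 2), w j * f₀ j :=
  Finset.sum_congr rfl fun j hj => by rw [h.apply_zero, if_pos (Finset.mem_range.1 hj)]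

/-- Weights with vanishing second difference give conserved quantities. -/
theorem sum_eq (h : IsCutoffSolution K f₀ T N f) (hK0 : ∀ k, K 0 k = 0) {w : ℕ → ℝ}
    (hw : ∀ m, w (m + 2) - 2 * w (m + 1) + w m = 0) {t : ℝ} (ht : t ∈ Set.Icc 0 T) :
    ∑ j ∈ Finset.range (N + 2), w j * f t j = ∑ j ∈ Finset.range (N + 2), w j * f₀ j := by
  rw [← h.sum_init]
  have hd := fun t ht => h.hasDerivWithinAt_sum hK0 w (t := t) ht
  simp only [hw, mul_zero, Finset.sum_const_zero] at hd
  exact constant_of_has_deriv_right_zero (fun s hs => (hd s hs).continuousWithinAt)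
    (fun s hs => (hd s (Set.Ico_subset_Icc_self hs)).mono_of_mem_nhdsWithin
      (Icc_mem_nhdsGE_of_mem hs)) t ht

theorem sum_shift_le (h : IsCutoffSolution K f₀ T N f) {w : ℕ → ℝ} (hw : ∀ j, 0 ≤ w j) {t : ℝ}
    (ht : t ∈ Set.Icc 0 T) : ∑ m ∈ Finset.range (N + 1), w (m + 1) * f t (m + 1) ≤
      ∑ j ∈ Finset.range (N + 2), w j * f t j := by
  rw [Finset.sum_range_succ' _ (N + 1)]
  exact le_add_of_nonneg_right (mul_nonneg (hw 0) (h.nonneg t ht 0))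

/-- The Riccati bound for the second moment. -/
theorem second_moment_le (h : IsCutoffSolution K f₀ T N f) (hK : ∀ j k, 0 ≤ K j k)
    (hK0 : ∀ k, K 0 k = 0) {C C' : ℝ} (hC : 0 < C) (hCC' : C < C')
    (hKC : ∀ j k : ℕ, K j k ≤ C * (j : ℝ) ^ 2 * (k : ℝ) ^ 2) {m : ℝ} (hm : 0 < m)
    (hfm : ∀ n, ∑ j ∈ Finset.range n, (j : ℝ) ^ 2 * f₀ j ≤ m) (hT : 2 * C' * m * T < 1)
    {t : ℝ} (ht : t ∈ Set.Icc 0 T) :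
    ∑ j ∈ Finset.range (N + 2), (j : ℝ) ^ 2 * f t j ≤ m / (1 - 2 * C' * m * T) := by
  have hC' : 0 < C' := hC.trans hCC'
  have hden : ∀ s ∈ Set.Icc 0 T, 1 - 2 * C' * m * T ≤ 1 - 2 * C' * m * s := by
    intro s hs
    have := hs.2
    gcongr
  have hden' : ∀ s ∈ Set.Icc 0 T, 0 < 1 - 2 * C' * m * s := fun s hs => by
    linarith [hden s hs]
  have hB : ∀ s ∈ Set.Icc 0 T, HasDerivAt (fun s => m / (1 - 2 * C' * m * s))
      (2 * C' * (m / (1 - 2 * C' * m * s)) ^ 2) s := by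
    intro s hs
    have h1 : HasDerivAt (fun s => 1 - 2 * C' * m * s) (-(2 * C' * m)) s := by
      simpa using ((hasDerivAt_id s).const_mul (2 * C' * m)).const_sub 1
    exact ((hasDerivAt_const s m).fun_div h1 (hden' s hs).ne').congr_deriv
      (by rw [div_pow]; ring)
  have hd := fun t ht => h.hasDerivWithinAt_sum hK0 (fun j => (j : ℝ) ^ 2) (t := t) ht
  refine (image_le_of_deriv_right_lt_deriv_boundary' (a := 0) (b := T)
    (fun s hs => (hd s hs).continuousWithinAt)
    (fun s hs => (hd s (Set.Ico_subset_Icc_self hs)).mono_of_mem_nhdsWithin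
      (Icc_mem_nhdsGE_of_mem hs)) (B := fun s => m / (1 - 2 * C' * m * s)) ?_
    (fun s hs => (hB s hs).continuousAt.continuousWithinAt)
    (fun s hs => (hB s (Set.Ico_subset_Icc_self hs)).hasDerivWithinAt) (fun s hs he => ?_) ht).trans
    (by
      have := hden t ht
      have : 0 < 1 - 2 * C' * m * T := by linarith
      gcongr)
  · rw [h.sum_init]
    simpa using hfm (N + 2)
  · have hs' := Set.Ico_subset_Icc_self hs
    rw [← he]
    set y := ∑ j ∈ Finset.range (N + 2), (j : ℝ) ^ 2 * f s j with hy
    have hypos : 0 < y := by rw [he]; exact div_pos hm (hden' s hs')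
    calc _ ≤ ∑ m ∈ Finset.range (N + 1),
          C * ((((m + 1 : ℕ) : ℝ)) ^ 2 * f s (m + 1)) * y * 2 := by
          refine Finset.sum_le_sum fun m _ => ?_
          have e : ((m + 2 : ℕ) : ℝ) ^ 2 - 2 * ((m + 1 : ℕ) : ℝ) ^ 2 + (m : ℝ) ^ 2 = 2 := by
            push_cast; ring
          rw [e]
          exact mul_le_mul_of_nonneg_right
            (flux_truncKernel_le hK hKC (h.nonneg s hs') N (m + 1)) zero_le_two
      _ = (2 * C * y) * ∑ m ∈ Finset.range (N + 1), ((m + 1 : ℕ) : ℝ) ^ 2 * f s (m + 1) := by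
          rw [Finset.mul_sum]
          exact Finset.sum_congr rfl fun m _ => by ring
      _ ≤ (2 * C * y) * y := by
          have := h.sum_shift_le (w := fun j => (j : ℝ) ^ 2) (fun j => by positivity) hs'
          gcongr
      _ < 2 * C' * y ^ 2 := by
          have := mul_lt_mul_of_pos_right hCC' (pow_pos hypos 2)
          linarith

/-- Propagation of moments with slowly varying weight. -/
theorem weighted_moment_le (h : IsCutoffSolution K f₀ T N f) (hK : ∀ j k, 0 ≤ K j k)
    (hK0 : ∀ k, K 0 k = 0) {C B : ℝ} (hC : 0 < C) (hB : 0 ≤ B)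
    (hKC : ∀ j k : ℕ, K j k ≤ C * (j : ℝ) ^ 2 * (k : ℝ) ^ 2)
    (hfB : ∀ t ∈ Set.Icc 0 T, ∑ j ∈ Finset.range (N + 2), (j : ℝ) ^ 2 * f t j ≤ B)
    {w : ℕ → ℝ} (hw : ∀ j, 0 ≤ w j) (hw2 : ∀ m, 0 ≤ w (m + 2) - 2 * w (m + 1) + w m) {c : ℝ}
    (hc : 0 ≤ c)
    (hwc : ∀ m : ℕ, ((m + 1 : ℕ) : ℝ) ^ 2 * (w (m + 2) - 2 * w (m + 1) + w m) ≤ c * w (m + 1))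
    {Y : ℝ} (hY : 0 < Y) (hfY : ∀ n, ∑ j ∈ Finset.range n, w j * f₀ j ≤ Y)
    {t : ℝ} (ht : t ∈ Set.Icc 0 T) :
    ∑ j ∈ Finset.range (N + 2), w j * f t j ≤ Y * Real.exp ((c * C * B + 1) * T) := by
  set κ := c * C * B with hκ
  have hκ0 : 0 ≤ κ := by positivity
  have hd := fun t ht => h.hasDerivWithinAt_sum hK0 w (t := t) ht
  have hE : ∀ s, HasDerivAt (fun s => Y * Real.exp ((κ + 1) * s))
      ((κ + 1) * (Y * Real.exp ((κ + 1) * s))) s := by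
    intro s
    exact ((((hasDerivAt_id s).const_mul (κ + 1)).exp).const_mul Y).congr_deriv (by
      simp only [id]; ring)
  refine (image_le_of_deriv_right_lt_deriv_boundary (a := 0) (b := T)
    (fun s hs => (hd s hs).continuousWithinAt)
    (fun s hs => (hd s (Set.Ico_subset_Icc_self hs)).mono_of_mem_nhdsWithin
      (Icc_mem_nhdsGE_of_mem hs)) ?_ hE (fun s hs he => ?_) ht).trans
    (by have := ht.2; gcongr)
  · rw [h.sum_init]
    simpa using hfY (N + 2)
  · have hs' := Set.Ico_subset_Icc_self hs
    rw [← he]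
    set y := ∑ j ∈ Finset.range (N + 2), w j * f s j with hy
    have hypos : 0 < y := by rw [he]; positivity
    calc _ ≤ ∑ m ∈ Finset.range (N + 1), C * B * (c * (w (m + 1) * f s (m + 1))) := by
          refine Finset.sum_le_sum fun m _ => ?_
          have hf := h.nonneg s hs' (m + 1)
          calc _ ≤ C * (((m + 1 : ℕ) : ℝ) ^ 2 * f s (m + 1)) * B *
                (w (m + 2) - 2 * w (m + 1) + w m) := by
                refine mul_le_mul_of_nonneg_right
                  ((flux_truncKernel_le hK hKC (h.nonneg s hs') N (m + 1)).trans ?_) (hw2 m)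
                exact mul_le_mul_of_nonneg_left (hfB s hs') (by positivity)
            _ = C * B * f s (m + 1) *
                (((m + 1 : ℕ) : ℝ) ^ 2 * (w (m + 2) - 2 * w (m + 1) + w m)) := by ring
            _ ≤ C * B * f s (m + 1) * (c * w (m + 1)) :=
                mul_le_mul_of_nonneg_left (hwc m) (by positivity)
            _ = _ := by ring
      _ = κ * ∑ m ∈ Finset.range (N + 1), w (m + 1) * f s (m + 1) := by
          rw [Finset.mul_sum]
          exact Finset.sum_congr rfl fun m _ => by rw [hκ]; ring
      _ ≤ κ * y := mul_le_mul_of_nonneg_left (h.sum_shift_le hw hs') hκ0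
      _ < (κ + 1) * y := by linarith

/-- Each component is Lipschitz in time, with a constant independent of the truncation. -/
theorem abs_sub_le (h : IsCutoffSolution K f₀ T N f) (hK : ∀ j k, 0 ≤ K j k)
    {C B : ℝ} (hC : 0 < C) (hB : 0 ≤ B)
    (hKC : ∀ j k : ℕ, K j k ≤ C * (j : ℝ) ^ 2 * (k : ℝ) ^ 2)
    (hfB : ∀ t ∈ Set.Icc 0 T, ∑ j ∈ Finset.range (N + 2), (j : ℝ) ^ 2 * f t j ≤ B)
    {s t : ℝ} (hs : s ∈ Set.Icc 0 T) (ht : t ∈ Set.Icc 0 T) (j : ℕ) :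
    |f t j - f s j| ≤ 4 * (C * B * B) * |t - s| := by
  have hflux : ∀ t ∈ Set.Icc 0 T, ∀ j, |flux (truncKernel K N) (f t) j| ≤ C * B * B := by
    intro t ht j
    have hnn := h.nonneg t ht
    rw [abs_of_nonneg (flux_nonneg (truncKernel_nonneg hK N) hnn j)]
    have hj : (j : ℝ) ^ 2 * f t j ≤ B := by
      by_cases hj : j < N + 2
      · exact (Finset.single_le_sum (f := fun j : ℕ => (j : ℝ) ^ 2 * f t j)
          (fun i _ => mul_nonneg (sq_nonneg _) (hnn i)) (Finset.mem_range.2 hj)).trans (hfB t ht)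
      · simpa [h.eq_zero t j (by omega)] using hB
    calc _ ≤ _ := flux_truncKernel_le hK hKC hnn N j
      _ ≤ C * B * B := by
        refine mul_le_mul (mul_le_mul_of_nonneg_left hj hC.le) (hfB t ht) ?_ (by positivity)
        exact Finset.sum_nonneg fun i _ => mul_nonneg (sq_nonneg _) (hnn i)
  have hlap : ∀ t ∈ Set.Icc 0 T,
      ‖lap (flux (truncKernel K N) (f t)) j‖ ≤ 4 * (C * B * B) := by
    intro t ht
    rw [Real.norm_eq_abs, abs_le]
    have hf := fun j => abs_le.1 (hflux t ht j)
    cases j with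
    | zero =>
      rw [lap]
      have : 0 ≤ C * B * B := by positivity
      constructor <;> linarith [hf 1]
    | succ m =>
      rw [lap]
      constructor <;> linarith [hf (m + 2), hf (m + 1), hf m]
  simpa only [Real.norm_eq_abs] using
    (convex_Icc 0 T).norm_image_sub_le_of_norm_hasDerivWithin_le
      (fun t ht => h.hasDeriv t ht j) hlap hs ht

end IsCutoffSolution

open Topology Asymptotics

/-- A de la Vallée-Poussin type weight: a sequence with finite second moment also has a finite
moment with respect to a convex weight `w` growing faster than `j²`, whose second difference is
controlled by `w_j / j²`. -/
theorem exists_slowly_varying_weight {a : ℕ → ℝ} (ha : ∀ j, 0 ≤ a j)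
    (hs : Summable fun j : ℕ => (j : ℝ) ^ 2 * a j) :
    ∃ w : ℕ → ℝ, (∀ j, 1 ≤ w j) ∧ (∀ m, 0 ≤ w (m + 2) - 2 * w (m + 1) + w m) ∧
      (∀ m : ℕ, ((m + 1 : ℕ) : ℝ) ^ 2 * (w (m + 2) - 2 * w (m + 1) + w m) ≤ 8 * w (m + 1)) ∧
      (fun j : ℕ => (j : ℝ) ^ 2) =o[atTop] w ∧ Summable fun j => w j * a j := by
  have htail := tendsto_sum_nat_add fun j : ℕ => (j : ℝ) ^ 2 * a j
  have hρ : ∀ i : ℕ, ∃ ρ : ℕ, ∀ r ≥ ρ,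
      ∑' k : ℕ, ((k + r : ℕ) : ℝ) ^ 2 * a (k + r) ≤ (1 / 2 : ℝ) ^ i := fun i =>
    eventually_atTop.1 (htail.eventually_le_const (by positivity))
  choose ρ hρ using hρ
  let R : ℕ → ℕ := fun i => 2 ^ i * (1 + ∑ l ∈ Finset.range (i + 1), ρ l)
  have hRρ : ∀ i, ρ i ≤ R i := fun i =>
    calc ρ i ≤ ∑ l ∈ Finset.range (i + 1), ρ l :=
          Finset.single_le_sum (fun _ _ => Nat.zero_le _) (Finset.self_mem_range_succ i)
      _ ≤ 1 * (1 + ∑ l ∈ Finset.range (i + 1), ρ l) := by omega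
      _ ≤ R i := Nat.mul_le_mul_right _ Nat.one_le_two_pow
  have hRlt : ∀ i, i < R i := fun i =>
    calc i < 2 ^ i := Nat.lt_two_pow_self
      _ = 2 ^ i * 1 := (mul_one _).symm
      _ ≤ R i := Nat.mul_le_mul_left _ (by omega)
  have hRdouble : ∀ i, 2 * R i ≤ R (i + 1) := fun i => by
    simp only [R]
    rw [pow_succ', mul_assoc, Finset.sum_range_succ _ (i + 1)]
    gcongr
    omega
  let s : ℕ → ℕ → ℝ := fun i j => ((j - R i : ℕ) : ℝ) ^ 2
  have hs0 : ∀ i j, 0 ≤ s i j := fun i j => sq_nonneg _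
  have hsz : ∀ i j, j ≤ R i → s i j = 0 := fun i j h => by
    simp [s, Nat.sub_eq_zero_of_le h]
  have hsdiff : ∀ i m, s i (m + 2) - 2 * s i (m + 1) + s i m =
      if R i ≤ m then 2 else if R i = m + 1 then 1 else 0 := by
    intro i m
    split_ifs with h1 h2
    · obtain ⟨d, rfl⟩ := Nat.exists_eq_add_of_le h1
      have e1 : R i + d + 2 - R i = d + 2 := by omega
      have e2 : R i + d + 1 - R i = d + 1 := by omega
      have e3 : R i + d - R i = d := by omega
      simp only [s, e1, e2, e3]
      push_cast; ring
    · rw [hsz i (m + 1) (by omega), hsz i m (by omega)]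
      have : m + 2 - R i = 1 := by omega
      simp [s, this]
    · rw [hsz i (m + 2) (by omega), hsz i (m + 1) (by omega), hsz i m (by omega)]
      ring
  have hshalf : ∀ i j : ℕ, 2 * R i ≤ j → (j : ℝ) ^ 2 ≤ 4 * s i j := by
    intro i j h
    have h' : (2 : ℝ) * R i ≤ j := by exact_mod_cast h
    have hR0 : (0 : ℝ) ≤ R i := Nat.cast_nonneg _
    simp only [s]
    rw [Nat.cast_sub (by omega)]
    nlinarith
  let w : ℕ → ℝ := fun j => 1 + (j : ℝ) ^ 2 + ∑ i ∈ Finset.range j, s i j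
  have hw : ∀ n j : ℕ, j ≤ n → w j = 1 + (j : ℝ) ^ 2 + ∑ i ∈ Finset.range n, s i j := by
    intro n j hjn
    simp only [w]
    congr 1
    refine Finset.sum_subset (Finset.range_subset_range.2 hjn) fun i _ hi => hsz i j ?_
    have := hRlt i
    have : j ≤ i := by simpa using hi
    omega
  have hwdiff : ∀ m, w (m + 2) - 2 * w (m + 1) + w m =
      2 + ∑ i ∈ Finset.range (m + 2), (s i (m + 2) - 2 * s i (m + 1) + s i m) := by
    intro m
    rw [hw (m + 2) (m + 2) le_rfl, hw (m + 2) (m + 1) (by omega), hw (m + 2) m (by omega),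
      Finset.sum_add_distrib, Finset.sum_sub_distrib, ← Finset.mul_sum]
    push_cast; ring
  have hsdiff0 : ∀ i m, 0 ≤ s i (m + 2) - 2 * s i (m + 1) + s i m := by
    intro i m
    rw [hsdiff]
    split_ifs <;> norm_num
  have hsdiff2 : ∀ i m, s i (m + 2) - 2 * s i (m + 1) + s i m ≤ 2 := by
    intro i m
    rw [hsdiff]
    split_ifs <;> norm_num
  refine ⟨w, fun j => ?_, fun m => ?_, fun m => ?_, Asymptotics.isLittleO_iff.2 fun η hη => ?_, ?_⟩
  · have := Finset.sum_nonneg fun i (_ : i ∈ Finset.range j) => hs0 i j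
    simp only [w]
    nlinarith [sq_nonneg (j : ℝ)]
  · rw [hwdiff]
    have := Finset.sum_nonneg fun i (_ : i ∈ Finset.range (m + 2)) => hsdiff0 i m
    linarith
  · rw [hwdiff, Finset.sum_range_succ', hw (m + 1) (m + 1) le_rfl]
    have hterm : ((m + 1 : ℕ) : ℝ) ^ 2 * ∑ i ∈ Finset.range (m + 1),
        (s (i + 1) (m + 2) - 2 * s (i + 1) (m + 1) + s (i + 1) m) ≤
        8 * ∑ i ∈ Finset.range (m + 1), s i (m + 1) := by
      rw [Finset.mul_sum, Finset.mul_sum]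
      refine Finset.sum_le_sum fun i _ => ?_
      by_cases h : R (i + 1) ≤ m + 1
      · have h1 := hshalf i (m + 1) ((hRdouble i).trans h)
        have h2 := mul_le_mul_of_nonneg_left (hsdiff2 (i + 1) m)
          (sq_nonneg ((m + 1 : ℕ) : ℝ))
        linarith
      · rw [hsdiff, if_neg (by omega), if_neg (by omega), mul_zero]
        exact mul_nonneg (by norm_num) (hs0 i _)
    have h0 := mul_le_mul_of_nonneg_left (hsdiff2 0 m) (sq_nonneg ((m + 1 : ℕ) : ℝ))
    have := sq_nonneg ((m + 1 : ℕ) : ℝ)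
    linarith
  · obtain ⟨n, hn⟩ := exists_nat_ge (4 / η)
    filter_upwards [eventually_ge_atTop (n + ∑ i ∈ Finset.range n, 2 * R i)] with j hj
    have h1 : ∀ i ∈ Finset.range n, (j : ℝ) ^ 2 / 4 ≤ s i j := by
      intro i hi
      have := hshalf i j (le_trans ((Finset.single_le_sum (f := fun i => 2 * R i)
        (fun _ _ => Nat.zero_le _) hi).trans (Nat.le_add_left _ n)) hj)
      linarith
    have h2 := Finset.card_nsmul_le_sum _ _ _ h1
    have h3 : ∑ i ∈ Finset.range n, s i j ≤ ∑ i ∈ Finset.range j, s i j :=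
      Finset.sum_le_sum_of_subset_of_nonneg
        (Finset.range_subset_range.2 ((Nat.le_add_right _ _).trans hj)) fun i _ _ => hs0 i j
    rw [Finset.card_range, nsmul_eq_mul] at h2
    have h4 := mul_le_mul_of_nonneg_right hn (sq_nonneg (j : ℝ))
    have h5 : (j : ℝ) ^ 2 = η * (4 / η * (j : ℝ) ^ 2 / 4) := by field_simp
    have h6 : 4 / η * (j : ℝ) ^ 2 / 4 ≤ w j := by
      simp only [w]
      linarith [sq_nonneg (j : ℝ)]
    rw [Real.norm_of_nonneg (sq_nonneg _), h5]
    exact mul_le_mul_of_nonneg_left (h6.trans (Real.le_norm_self _)) hη.le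
  · have hsum0 : Summable a := by
      rw [← summable_nat_add_iff 1] at hs ⊢
      refine Summable.of_nonneg_of_le (fun j => ha _) (fun j => ?_) hs
      refine le_mul_of_one_le_left (ha _) (one_le_pow₀ ?_)
      exact_mod_cast Nat.le_add_left 1 j
    have hinner : ∀ i n, ∑ j ∈ Finset.range n, s i j * a j ≤ (1 / 2 : ℝ) ^ i := by
      intro i n
      have hsr := (summable_nat_add_iff (R i)).2 hs
      calc ∑ j ∈ Finset.range n, s i j * a j
          ≤ ∑ j ∈ Finset.range (R i + n), s i j * a j :=
            Finset.sum_le_sum_of_subset_of_nonneg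
              (Finset.range_subset_range.2 (Nat.le_add_left _ _))
              fun j _ _ => mul_nonneg (hs0 i j) (ha j)
        _ = ∑ k ∈ Finset.range n, s i (R i + k) * a (R i + k) := by
            rw [Finset.sum_range_add, add_eq_right]
            refine Finset.sum_eq_zero fun j hj => ?_
            rw [hsz i j (Finset.mem_range.1 hj).le, zero_mul]
        _ ≤ ∑ k ∈ Finset.range n, ((k + R i : ℕ) : ℝ) ^ 2 * a (k + R i) := by
            refine Finset.sum_le_sum fun k _ => ?_
            rw [add_comm (R i) k]
            refine mul_le_mul_of_nonneg_right ?_ (ha _)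
            simp only [s]
            gcongr
            omega
        _ ≤ _ := (hsr.sum_le_tsum _ fun k _ => mul_nonneg (sq_nonneg _) (ha _)).trans
            (hρ i _ (hRρ i))
    have hsum2 : Summable fun j => (∑ i ∈ Finset.range j, s i j) * a j := by
      refine summable_of_sum_range_le (c := 2)
        (fun j => mul_nonneg (Finset.sum_nonneg fun i _ => hs0 i j) (ha j)) fun n => ?_
      calc ∑ j ∈ Finset.range n, (∑ i ∈ Finset.range j, s i j) * a j
          ≤ ∑ j ∈ Finset.range n, (∑ i ∈ Finset.range n, s i j) * a j := by
            refine Finset.sum_le_sum fun j hj => mul_le_mul_of_nonneg_right ?_ (ha j)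
            exact Finset.sum_le_sum_of_subset_of_nonneg
              (Finset.range_subset_range.2 (Finset.mem_range.1 hj).le) fun i _ _ => hs0 i j
        _ = ∑ i ∈ Finset.range n, ∑ j ∈ Finset.range n, s i j * a j := by
            simp only [Finset.sum_mul]
            exact Finset.sum_comm
        _ ≤ ∑ i ∈ Finset.range n, (1 / 2 : ℝ) ^ i := Finset.sum_le_sum fun i _ => hinner i n
        _ ≤ 2 := sum_geometric_two_le n
    refine ((hsum0.add hs).add hsum2).congr fun j => ?_
    simp only [w]
    ring

/-- Nonnegative sequences whose moment with weight `w` is at most `W`. -/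
def boundedMoment (w : ℕ → ℝ) (W : ℝ) : Set (ℕ → ℝ) :=
  {g | (∀ j, 0 ≤ g j) ∧ ∀ n, ∑ j ∈ Finset.range n, w j * g j ≤ W}

section boundedMoment

variable {w c : ℕ → ℝ} {W : ℝ} {g : ℕ → ℝ}

theorem apply_le_of_mem_boundedMoment (hw : ∀ j, 1 ≤ w j) (hg : g ∈ boundedMoment w W) (j : ℕ) :
    g j ≤ W :=
  calc g j ≤ w j * g j := le_mul_of_one_le_left (hg.1 j) (hw j)
    _ ≤ ∑ i ∈ Finset.range (j + 1), w i * g i :=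
      Finset.single_le_sum (f := fun i => w i * g i)
        (fun i _ => mul_nonneg (zero_le_one.trans (hw i)) (hg.1 i)) (Finset.self_mem_range_succ j)
    _ ≤ W := hg.2 _

theorem isCompact_boundedMoment (hw : ∀ j, 1 ≤ w j) : IsCompact (boundedMoment w W) := by
  refine (isCompact_univ_pi fun _ : ℕ => isCompact_Icc (a := (0 : ℝ)) (b := W)).of_isClosed_subset
    ?_ fun g hg j _ => ⟨hg.1 j, apply_le_of_mem_boundedMoment hw hg j⟩
  simp only [boundedMoment, Set.ofPred_and, Set.ofPred_forall]
  refine (isClosed_iInter fun j => isClosed_le continuous_const (continuous_apply j)).inter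
    (isClosed_iInter fun n => isClosed_le ?_ continuous_const)
  exact continuous_finsetSum _ fun j _ => continuous_const.mul (continuous_apply j)

/-- Uniform control of the tails of series against sequences in `boundedMoment w W`. -/
theorem abs_tsum_sub_sum_le (hw : ∀ j, 1 ≤ w j) (hg : g ∈ boundedMoment w W) {η : ℝ}
    (hη : 0 ≤ η) {J : ℕ} (hc : ∀ j ≥ J, |c j| ≤ η * w j) :
    Summable (fun j => c j * g j) ∧
      |∑' j, c j * g j - ∑ j ∈ Finset.range J, c j * g j| ≤ η * W := by
  have hwg : ∀ j, 0 ≤ w j * g j := fun j => mul_nonneg (zero_le_one.trans (hw j)) (hg.1 j)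
  have hsum : Summable fun j => w j * g j := summable_of_sum_range_le hwg hg.2
  have hbound : ∀ k, ‖c (k + J) * g (k + J)‖ ≤ η * (w (k + J) * g (k + J)) := fun k => by
    rw [norm_mul, Real.norm_eq_abs, Real.norm_of_nonneg (hg.1 _), ← mul_assoc]
    exact mul_le_mul_of_nonneg_right (hc _ (Nat.le_add_left _ _)) (hg.1 _)
  have hsumJ := ((summable_nat_add_iff J).2 hsum).mul_left η
  have hcg : Summable fun j => c j * g j :=
    (summable_nat_add_iff J).1 (Summable.of_norm_bounded hsumJ hbound)
  refine ⟨hcg, ?_⟩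
  rw [← hcg.sum_add_tsum_nat_add J, add_sub_cancel_left, ← Real.norm_eq_abs]
  refine (tsum_of_norm_bounded hsumJ.hasSum hbound).trans ?_
  rw [tsum_mul_left]
  refine mul_le_mul_of_nonneg_left ?_ hη
  have h1 := hsum.sum_add_tsum_nat_add J
  have h2 := Finset.sum_nonneg fun j (_ : j ∈ Finset.range J) => hwg j
  have h3 := hsum.tsum_le_of_sum_range_le hg.2
  linarith

theorem exists_forall_abs_le_mul (hw : ∀ j, 1 ≤ w j) (hc : c =o[atTop] w) {η : ℝ}
    (hη : 0 < η) : ∃ J, ∀ j ≥ J, |c j| ≤ η * w j := by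
  obtain ⟨J, hJ⟩ := eventually_atTop.1 (isLittleO_iff.1 hc hη)
  refine ⟨J, fun j hj => ?_⟩
  simpa only [Real.norm_eq_abs, abs_of_nonneg (zero_le_one.trans (hw j))] using hJ j hj

theorem summable_of_isLittleO (hw : ∀ j, 1 ≤ w j) (hc : c =o[atTop] w)
    (hg : g ∈ boundedMoment w W) : Summable fun j => c j * g j := by
  obtain ⟨J, hJ⟩ := exists_forall_abs_le_mul hw hc one_pos
  exact (abs_tsum_sub_sum_le hw hg zero_le_one hJ).1

theorem continuousOn_tsum_boundedMoment (hw : ∀ j, 1 ≤ w j) (hW : 0 < W) (hc : c =o[atTop] w) :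
    ContinuousOn (fun g : ℕ → ℝ => ∑' j, c j * g j) (boundedMoment w W) := by
  have hlim : TendstoUniformlyOn (fun (n : ℕ) (g : ℕ → ℝ) => ∑ j ∈ Finset.range n, c j * g j)
      (fun g => ∑' j, c j * g j) atTop (boundedMoment w W) := by
    refine Metric.tendstoUniformlyOn_iff.2 fun ε hε => ?_
    obtain ⟨J, hJ⟩ := exists_forall_abs_le_mul hw hc (η := ε / (2 * W)) (by positivity)
    filter_upwards [eventually_ge_atTop J] with n hn g hg
    have := (abs_tsum_sub_sum_le hw hg (by positivity) fun j hj => hJ j (hn.trans hj)).2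
    rw [Real.dist_eq]
    refine this.trans_lt ?_
    rw [div_mul_eq_mul_div, div_lt_iff₀ (by positivity)]
    nlinarith [mul_pos hε hW]
  refine hlim.continuousOn (Frequently.of_forall fun n => Continuous.continuousOn ?_)
  exact continuous_finsetSum _ fun j _ => continuous_const.mul (continuous_apply j)

theorem continuousOn_lap {X : Type*} [TopologicalSpace X] {s : Set X} {a : X → ℕ → ℝ}
    (ha : ∀ j, ContinuousOn (fun x => a x j) s) (j : ℕ) :
    ContinuousOn (fun x => lap (a x) j) s := by
  cases j with
  | zero => exact ha 1
  | succ m => exact ((ha _).sub (continuousOn_const.mul (ha _))).add (ha _)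

variable {K : ℕ → ℕ → ℝ}

theorem continuousOn_flux (hw : ∀ j, 1 ≤ w j) (hW : 0 < W) (hKw : ∀ j, K j =o[atTop] w) (j : ℕ) :
    ContinuousOn (fun g => flux K g j) (boundedMoment w W) :=
  (continuous_apply j).continuousOn.mul (continuousOn_tsum_boundedMoment hw hW (hKw j))

theorem tendstoUniformlyOn_flux_truncKernel (hw : ∀ j, 1 ≤ w j) (hW : 0 < W)
    (hKw : ∀ j, K j =o[atTop] w) (j : ℕ) :
    TendstoUniformlyOn (fun N g => flux (truncKernel K N) g j) (fun g => flux K g j) atTop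
      (boundedMoment w W) := by
  refine Metric.tendstoUniformlyOn_iff.2 fun ε hε => ?_
  have hη : 0 < ε / (2 * W ^ 2) := by positivity
  obtain ⟨J, hJ⟩ := exists_forall_abs_le_mul hw (hKw j) hη
  filter_upwards [eventually_ge_atTop (max J j)] with N hN g hg
  have hNJ : J ≤ N := (le_max_left _ _).trans hN
  have hNj : j ≤ N := (le_max_right _ _).trans hN
  have h1 : ∀ k ≥ J, |truncKernel K N j k| ≤ ε / (2 * W ^ 2) * w k := fun k hk => by
    unfold truncKernel
    split_ifs
    · exact hJ k hk
    · rw [abs_zero]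
      exact (abs_nonneg _).trans (hJ k hk)
  have h2 : ∀ k ≥ J, |K j k - truncKernel K N j k| ≤ ε / (2 * W ^ 2) * w k := fun k hk => by
    unfold truncKernel
    split_ifs
    · rw [sub_self, abs_zero]
      exact (abs_nonneg _).trans (hJ k hk)
    · rw [sub_zero]
      exact hJ k hk
  have h3 : ∑ k ∈ Finset.range J, (K j k - truncKernel K N j k) * g k = 0 := by
    refine Finset.sum_eq_zero fun k hk => ?_
    have : k ≤ N := (Finset.mem_range.1 hk).le.trans hNJ
    simp [truncKernel, hNj, this]
  have h4 := (abs_tsum_sub_sum_le hw hg hη.le h2).2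
  rw [h3, sub_zero] at h4
  simp only [sub_mul] at h4
  rw [(abs_tsum_sub_sum_le hw hg hη.le hJ).1.tsum_sub (abs_tsum_sub_sum_le hw hg hη.le h1).1] at h4
  rw [Real.dist_eq, flux, flux, ← mul_sub, abs_mul, abs_of_nonneg (hg.1 j)]
  calc _ ≤ W * (ε / (2 * W ^ 2) * W) :=
        mul_le_mul (apply_le_of_mem_boundedMoment hw hg j) h4 (abs_nonneg _) hW.le
    _ = ε / 2 := by field_simp
    _ < ε := half_lt_self hε

theorem tendstoUniformlyOn_lap {X : Type*} {s : Set X} {a : ℕ → X → ℕ → ℝ} {b : X → ℕ → ℝ}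
    (h : ∀ j, TendstoUniformlyOn (fun N x => a N x j) (fun x => b x j) atTop s) (j : ℕ) :
    TendstoUniformlyOn (fun N x => lap (a N x) j) (fun x => lap (b x) j) atTop s := by
  cases j with
  | zero => exact h 1
  | succ m =>
    have := ((h (m + 2)).fun_sub ((h (m + 1)).fun_add (h (m + 1)))).fun_add (h m)
    simpa only [lap, two_mul] using this

end boundedMoment

/-- Compactness: limits along an ultrafilter of approximate solutions in a compact set of sequences
are solutions of the limiting infinite system. -/
theorem exists_limit_solution {S : Set (ℕ → ℝ)} (hS : IsCompact S)
    {V : ℕ → (ℕ → ℝ) → ℕ → ℝ} {U : (ℕ → ℝ) → ℕ → ℝ}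
    (hU : ∀ j, ContinuousOn (fun g => U g j) S)
    (hVU : ∀ j, TendstoUniformlyOn (fun N g => V N g j) (fun g => U g j) atTop S)
    {I : Set ℝ} (hI : Convex ℝ I) {x : ℕ → ℝ → ℕ → ℝ} (hxS : ∀ N, ∀ t ∈ I, x N t ∈ S)
    (hx : ∀ N, ∀ t ∈ I, ∀ j, HasDerivWithinAt (fun s => x N s j) (V N (x N t) j) I t) {Λ : ℝ}
    (hΛ : ∀ N, ∀ s ∈ I, ∀ t ∈ I, ∀ j, |x N t j - x N s j| ≤ Λ * |t - s|) :
    ∃ (f : ℝ → ℕ → ℝ) (u : Ultrafilter ℕ), ↑u ≤ (atTop : Filter ℕ) ∧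
      (∀ t ∈ I, Tendsto (fun N => x N t) u (𝓝 (f t))) ∧ (∀ t ∈ I, f t ∈ S) ∧
      (∀ t ∈ I, ∀ j, HasDerivWithinAt (fun s => f s j) (U (f t) j) I t) := by
  let u : Ultrafilter ℕ := hyperfilter ℕ
  have hu : (u : Filter ℕ) ≤ atTop := by
    rw [← Nat.cofinite_eq_atTop]
    exact hyperfilter_le_cofinite
  have hlim : ∀ t, ∃ y, t ∈ I → y ∈ S ∧ Tendsto (fun N => x N t) u (𝓝 y) := by
    intro t
    by_cases ht : t ∈ I
    · obtain ⟨y, hyS, hy⟩ := hS.ultrafilter_le_nhds' (u.map fun N => x N t)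
        (Ultrafilter.mem_map.2 (Filter.univ_mem' fun N => hxS N t ht))
      exact ⟨y, fun _ => ⟨hyS, hy⟩⟩
    · exact ⟨0, fun h => absurd h ht⟩
  choose f hf using hlim
  refine ⟨f, u, hu, fun t ht => (hf t ht).2, fun t ht => (hf t ht).1, fun t ht j => ?_⟩
  rw [hasDerivWithinAt_iff_isLittleO, isLittleO_iff]
  intro ε hε
  have hunif := hS.uniformContinuousOn_of_continuous (hU j)
  have hequi : Tendsto (fun p : ℕ × ℝ => (x p.1 p.2, x p.1 t)) (⊤ ×ˢ 𝓝[I] t)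
      (uniformity (ℕ → ℝ) ⊓ 𝓟 (S ×ˢ S)) := by
    have hmem : ∀ᶠ p : ℕ × ℝ in ⊤ ×ˢ 𝓝[I] t, p.2 ∈ I :=
      tendsto_snd.eventually self_mem_nhdsWithin
    refine tendsto_inf.2 ⟨?_, tendsto_principal.2 ?_⟩
    · rw [Pi.uniformity]
      refine tendsto_iInf.2 fun i => tendsto_comap_iff.2 ?_
      refine tendsto_uniformity_iff_dist_tendsto_zero.2 ?_
      have h0 : Tendsto (fun p : ℕ × ℝ => Λ * |p.2 - t|) (⊤ ×ˢ 𝓝[I] t) (𝓝 0) := by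
        have : Tendsto (fun s : ℝ => Λ * |s - t|) (𝓝[I] t) (𝓝 0) := by
          have hc : Continuous fun s : ℝ => Λ * |s - t| := by fun_prop
          simpa using (hc.tendsto t).mono_left nhdsWithin_le_nhds
        exact this.comp tendsto_snd
      refine squeeze_zero' (Eventually.of_forall fun p => dist_nonneg) ?_ h0
      filter_upwards [hmem] with p hp
      exact hΛ p.1 t ht p.2 hp i
    · filter_upwards [hmem] with p hp
      exact ⟨hxS _ _ hp, hxS _ _ ht⟩
  have hclose : ∀ᶠ s in 𝓝[I] t, ∀ N, |U (x N s) j - U (x N t) j| < ε / 2 := by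
    have h := (Tendsto.comp hunif hequi).eventually (Metric.dist_mem_uniformity (half_pos hε))
    rw [eventually_swap_iff] at h
    refine h.curry.mono fun s hs N => ?_
    exact eventually_top.1 hs N
  obtain ⟨δ, hδ, hball⟩ := Metric.mem_nhdsWithin_iff.1 hclose
  have hNlarge : ∀ᶠ N in (u : Filter ℕ), ∀ g ∈ S, |V N g j - U g j| < ε / 2 := by
    refine hu ?_
    filter_upwards [Metric.tendstoUniformlyOn_iff.1 (hVU j) _ (half_pos hε)] with N hN g hg
    rw [← Real.dist_eq, dist_comm]
    exact hN g hg
  have hUlim : Tendsto (fun N => U (x N t) j) u (𝓝 (U (f t) j)) :=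
    (hU j (f t) (hf t ht).1).tendsto.comp
      (tendsto_nhdsWithin_iff.2 ⟨(hf t ht).2, Eventually.of_forall fun N => hxS N t ht⟩)
  have hcoord : ∀ s ∈ I, Tendsto (fun N => x N s j) u (𝓝 (f s j)) := fun s hs =>
    tendsto_pi_nhds.1 (hf s hs).2 j
  filter_upwards [inter_mem (mem_nhdsWithin_of_mem_nhds (Metric.ball_mem_nhds t hδ))
    self_mem_nhdsWithin] with s hs
  refine le_of_tendsto ((((hcoord s hs.2).sub (hcoord t ht)).sub
    (hUlim.const_smul (s - t))).norm) ?_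
  filter_upwards [hNlarge] with N hN
  have hconv : Convex ℝ (Metric.ball t δ ∩ I) := (convex_ball t δ).inter hI
  have hd : ∀ r ∈ Metric.ball t δ ∩ I, HasDerivWithinAt (fun r => x N r j - r * U (x N t) j)
      (V N (x N r) j - U (x N t) j) (Metric.ball t δ ∩ I) r := fun r hr => by
    refine (((hx N r hr.2 j).mono Set.inter_subset_right).fun_sub
      ((hasDerivWithinAt_id r (Metric.ball t δ ∩ I)).mul_const (U (x N t) j))).congr_deriv ?_
    rw [one_mul]
  have := hconv.norm_image_sub_le_of_norm_hasDerivWithin_le (C := ε) hd (fun r hr => ?_)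
    ⟨Metric.mem_ball_self hδ, ht⟩ hs
  · refine le_trans (le_of_eq ?_) this
    congr 1
    rw [smul_eq_mul]
    ring
  · have h1 := hN _ (hxS N r hr.2)
    have h2 : |U (x N r) j - U (x N t) j| < ε / 2 := hball hr N
    rw [Real.norm_eq_abs]
    rw [abs_lt] at h1 h2
    rw [abs_le]
    constructor <;> linarith

theorem edgRHS_eq_lap_flux {K : ℕ → ℕ → ℝ} (hK : ∀ j k, K j k = K k j) (hK0 : ∀ k, K 0 k = 0)
    {g : ℕ → ℝ} (hg : ∀ j, Summable fun k => K j k * g k) (j : ℕ) :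
    edgRHS K g j = lap (flux K g) j := by
  have hshift : ∀ m, ∑' k, K (k + 1) m * g (k + 1) = ∑' k, K m k * g k := fun m => by
    simp_rw [hK _ m]
    rw [(hg m).tsum_eq_zero_add, hK m 0, hK0, zero_mul, zero_add]
  cases j with
  | zero => simp [edgRHS, lap, flux, hshift, hK0]
  | succ m =>
    rw [edgRHS, hshift, hshift, lap, flux, flux, flux]
    ring

theorem exists_gt_mul_lt_one {C q : ℝ} (hq : 0 ≤ q) (h : q * C < 1) :
    ∃ C', C < C' ∧ q * C' < 1 := by
  refine ⟨C + (1 - q * C) / (q + 1), lt_add_of_pos_right _ (div_pos (by linarith) (by linarith)),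
    ?_⟩
  have : q * (C + (1 - q * C) / (q + 1)) = 1 - (1 - q * C) / (q + 1) := by
    field_simp
    ring
  rw [this]
  exact sub_lt_self _ (div_pos (by linarith) (by linarith))

namespace IsCutoffSolution

variable {K : ℕ → ℕ → ℝ} {f₀ : ℕ → ℝ} {T : ℝ} {N : ℕ} {f : ℝ → ℕ → ℝ}

theorem mem_boundedMoment (h : IsCutoffSolution K f₀ T N f) {w : ℕ → ℝ} (hw : ∀ j, 0 ≤ w j)
    {W t : ℝ} (ht : t ∈ Set.Icc 0 T) (hW : ∑ j ∈ Finset.range (N + 2), w j * f t j ≤ W) :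
    f t ∈ boundedMoment w W := by
  refine ⟨h.nonneg t ht, fun n => le_trans ?_ hW⟩
  have hnn : ∀ j, 0 ≤ w j * f t j := fun j => mul_nonneg (hw j) (h.nonneg t ht j)
  refine (Finset.sum_le_sum_of_subset_of_nonneg
    (Finset.range_subset_range.2 (le_max_left n (N + 2))) fun j _ _ => hnn j).trans_eq ?_
  refine (Finset.sum_subset (Finset.range_subset_range.2 (le_max_right n (N + 2)))
    fun j _ hj => ?_).symm
  rw [h.eq_zero t j (not_lt.1 fun hlt => hj (Finset.mem_range.2 hlt)), mul_zero]

theorem tsum_eq (h : IsCutoffSolution K f₀ T N f) (hK0 : ∀ k, K 0 k = 0) {c : ℕ → ℝ}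
    (hc : ∀ m, c (m + 2) - 2 * c (m + 1) + c m = 0) {t : ℝ} (ht : t ∈ Set.Icc 0 T) :
    ∑' j, c j * f t j = ∑ j ∈ Finset.range (N + 2), c j * f₀ j := by
  rw [← h.sum_eq hK0 hc ht]
  refine tsum_eq_sum fun j hj => ?_
  rw [h.eq_zero t j (not_lt.1 fun hlt => hj (Finset.mem_range.2 hlt)), mul_zero]

end IsCutoffSolution

/-- Linear functionals conserved by the cut-off systems are conserved by their limits. -/
theorem tsum_eq_of_tendsto {K : ℕ → ℕ → ℝ} (hK0 : ∀ k, K 0 k = 0) {f₀ : ℕ → ℝ} {T : ℝ}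
    {x : ℕ → ℝ → ℕ → ℝ} (hx : ∀ N, IsCutoffSolution K f₀ T N (x N)) {w : ℕ → ℝ} {W : ℝ}
    (hw : ∀ j, 1 ≤ w j) (hW : 0 < W) {t : ℝ} (ht : t ∈ Set.Icc 0 T)
    (hxS : ∀ N, x N t ∈ boundedMoment w W) {y : ℕ → ℝ} (hy : y ∈ boundedMoment w W)
    (hf₀ : f₀ ∈ boundedMoment w W) {u : Filter ℕ} [u.NeBot] (hu : u ≤ atTop)
    (hxy : Tendsto (fun N => x N t) u (𝓝 y)) {c : ℕ → ℝ} (hcw : c =o[atTop] w)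
    (hc : ∀ m, c (m + 2) - 2 * c (m + 1) + c m = 0) :
    ∑' j, c j * y j = ∑' j, c j * f₀ j := by
  have h1 : Tendsto (fun N => ∑' j, c j * x N t j) u (𝓝 (∑' j, c j * y j)) :=
    ((continuousOn_tsum_boundedMoment hw hW hcw) y hy).tendsto.comp
      (tendsto_nhdsWithin_iff.2 ⟨hxy, Eventually.of_forall hxS⟩)
  refine tendsto_nhds_unique h1 ?_
  simp only [fun N => (hx N).tsum_eq hK0 hc ht]
  exact (((summable_of_isLittleO hw hcw hf₀).tendsto_sum_tsum_nat).comp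
    (tendsto_add_atTop_nat 2)).mono_left hu

/-- Theorem 2.5: local existence of a classical, mass- and
number-conserving solution for kernels `K_{j,k} ≤ C j² k²`. -/
theorem edg_local_existence (K : ℕ → ℕ → ℝ) (C : ℝ) (f0 : ℕ → ℝ) (T0 : ℝ)
    (hKnn : ∀ j k : ℕ, 0 ≤ K j k) (hKsym : ∀ j k : ℕ, K j k = K k j) (hC : 0 < C)
    (hKle : ∀ j k : ℕ, K j k ≤ C * (j : ℝ) ^ 2 * (k : ℝ) ^ 2)
    (hf0 : MemYplus 2 f0) (hM2 : 0 < mom 2 f0)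
    (hT0 : 0 ≤ T0) (hT0' : T0 < (2 * mom 2 f0 * C)⁻¹) :
    ∃ f : ℝ → ℕ → ℝ, f 0 = f0 ∧
      (∀ t ∈ Set.Icc (0:ℝ) T0, MemYplus 2 (f t)) ∧
      IsClassicalSolutionOn K f (Set.Icc 0 T0) ∧
      (∀ t ∈ Set.Icc (0:ℝ) T0, mom 0 (f t) = mom 0 f0 ∧ mom 1 (f t) = mom 1 f0) := by
  have hK0 : ∀ k, K 0 k = 0 := fun k => le_antisymm (by simpa using hKle 0 k) (hKnn 0 k)
  have hf2 : Summable fun j : ℕ => (j : ℝ) ^ 2 * f0 j := by simpa [Real.rpow_two] using hf0.2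
  set m := mom 2 f0 with hm
  have hfm : ∀ n, ∑ j ∈ Finset.range n, (j : ℝ) ^ 2 * f0 j ≤ m := fun n => by
    simp only [hm, mom, Real.rpow_two]
    exact hf2.sum_le_tsum _ fun j _ => mul_nonneg (sq_nonneg _) (hf0.1 j)
  have hCT : 2 * m * T0 * C < 1 := by
    rw [← one_div, lt_div_iff₀ (by positivity)] at hT0'
    linarith
  obtain ⟨C', hCC', hC'T⟩ := exists_gt_mul_lt_one (by positivity) hCT
  replace hC'T : 2 * C' * m * T0 < 1 := by linarith
  set B := m / (1 - 2 * C' * m * T0) with hBdef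
  have hB : 0 ≤ B := div_nonneg hM2.le (by linarith)
  obtain ⟨w, hw, hw2, hwc, hsw, hwf⟩ := exists_slowly_varying_weight hf0.1 hf2
  have hw0 : ∀ j, 0 ≤ w j := fun j => zero_le_one.trans (hw j)
  have hwf0 : ∀ j, 0 ≤ w j * f0 j := fun j => mul_nonneg (hw0 j) (hf0.1 j)
  set Y := ∑' j, w j * f0 j + 1 with hYdef
  have hY : 0 < Y := add_pos_of_nonneg_of_pos (tsum_nonneg hwf0) one_pos
  have hfY : ∀ n, ∑ j ∈ Finset.range n, w j * f0 j ≤ Y := fun n =>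
    (hwf.sum_le_tsum _ fun j _ => hwf0 j).trans (le_add_of_nonneg_right zero_le_one)
  set W := Y * Real.exp ((8 * C * B + 1) * T0) with hWdef
  have hW : 0 < W := by positivity
  have hfS : f0 ∈ boundedMoment w W := ⟨hf0.1, fun n => (hfY n).trans
    (le_mul_of_one_le_right hY.le (Real.one_le_exp (by positivity)))⟩
  have hKw : ∀ j, K j =o[atTop] w := fun j => by
    refine IsBigO.trans_isLittleO (IsBigO.of_bound (C * (j : ℝ) ^ 2)
      (Eventually.of_forall fun k => ?_)) hsw
    rw [Real.norm_of_nonneg (hKnn j k), Real.norm_of_nonneg (sq_nonneg _)]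
    exact hKle j k
  choose x hx using exists_isCutoffSolution hKnn hK0 hf0.1 hT0
  have hxB : ∀ N, ∀ t ∈ Set.Icc 0 T0, ∑ j ∈ Finset.range (N + 2), (j : ℝ) ^ 2 * x N t j ≤ B :=
    fun N t ht => (hx N).second_moment_le hKnn hK0 hC hCC' hKle hM2 hfm hC'T ht
  have hxS : ∀ N, ∀ t ∈ Set.Icc 0 T0, x N t ∈ boundedMoment w W := fun N t ht =>
    (hx N).mem_boundedMoment hw0 ht ((hx N).weighted_moment_le hKnn hK0 hC hB hKle (hxB N) hw0 hw2
      (by norm_num) hwc hY hfY ht)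
  have hUc := fun j => continuousOn_lap (continuousOn_flux hw hW hKw) j
  obtain ⟨f, u, hu, hxf, hfmem, hf⟩ := exists_limit_solution (isCompact_boundedMoment hw) hUc
    (tendstoUniformlyOn_lap (tendstoUniformlyOn_flux_truncKernel hw hW hKw)) (convex_Icc 0 T0)
    hxS (fun N => (hx N).hasDeriv)
    fun N s hs t ht j => (hx N).abs_sub_le hKnn hC hB hKle (hxB N) hs ht j
  have hKf : ∀ t ∈ Set.Icc 0 T0, ∀ j, Summable fun k => K j k * f t k := fun t ht j =>
    summable_of_isLittleO hw (hKw j) (hfmem t ht)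
  have hRHS : ∀ t ∈ Set.Icc 0 T0, ∀ j, edgRHS K (f t) j = lap (flux K (f t)) j := fun t ht =>
    edgRHS_eq_lap_flux hKsym hK0 (hKf t ht)
  have hsq : ∀ᶠ j : ℕ in atTop, (1 : ℝ) ≤ j := by
    filter_upwards [eventually_ge_atTop 1] with j hj
    exact_mod_cast hj
  refine ⟨f, ?_, fun t ht => ⟨(hfmem t ht).1, ?_⟩, ⟨fun t ht j => ⟨hKf t ht j, ?_⟩,
    fun t ht j => ?_, fun j => ?_⟩, fun t ht => ⟨?_, ?_⟩⟩
  · funext j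
    have h0 : (0 : ℝ) ∈ Set.Icc 0 T0 := Set.left_mem_Icc.2 hT0
    refine tendsto_nhds_unique (tendsto_pi_nhds.1 (hxf 0 h0) j) (tendsto_const_nhds.congr' (hu ?_))
    filter_upwards [eventually_ge_atTop j] with N hN
    rw [(hx N).apply_zero, if_pos (by omega)]
  · simpa [Real.rpow_two] using summable_of_isLittleO hw hsw (hfmem t ht)
  · simp_rw [hKsym _ j]
    exact (summable_nat_add_iff 1).2 (hKf t ht j)
  · rw [hRHS t ht]
    exact hf t ht j
  · have hfc : ContinuousOn f (Set.Icc 0 T0) :=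
      continuousOn_pi.2 fun j t ht => (hf t ht j).continuousWithinAt
    exact ((hUc j).comp hfc hfmem).congr fun t ht => hRHS t ht j
  · have hc : (fun _ : ℕ => (1 : ℝ)) =o[atTop] w := by
      refine IsBigO.trans_isLittleO (IsBigO.of_bound 1 ?_) hsw
      filter_upwards [hsq] with j hj
      rw [norm_one, one_mul, Real.norm_of_nonneg (sq_nonneg _)]
      exact one_le_pow₀ hj
    simpa [mom] using tsum_eq_of_tendsto hK0 hx hw hW ht (fun N => hxS N t ht) (hfmem t ht) hfS hu
      (hxf t ht) hc fun m => by norm_num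
  · have hc : (fun j : ℕ => (j : ℝ)) =o[atTop] w := by
      refine IsBigO.trans_isLittleO (IsBigO.of_bound 1 ?_) hsw
      filter_upwards [hsq] with j hj
      rw [one_mul, Real.norm_of_nonneg (zero_le_one.trans hj), Real.norm_of_nonneg (sq_nonneg _)]
      exact le_self_pow₀ hj two_ne_zero
    simpa [mom] using tsum_eq_of_tendsto hK0 hx hw hW ht (fun N => hxS N t ht) (hfmem t ht) hfS hu
      (hxf t ht) hc fun m => by push_cast; ring
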